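/- Let d, m, w : ℕ with m ≥ 1. Consider a finite rooted tree of height at most d in which every node has at most m children and, for every node, at most w of its children are internal nodes (nodes having at least one child). Then the total number of nodes of the tree is at most 1 + m · ∑_{i=0}^{d-1} w^i. (This bounds the size of any proof tree produced by the grounder BC_{w,d}: each rule application contributes at most m body atoms, of which at most w are unknown sub-goals that are further expanded, up to depth d.) -/

import Mathlib

/-- A finite rooted tree: each node carries a list of child subtrees. -/
inductive RTree : Type where
  | node : List RTree → RTree

namespace RTree

/-- The children of the root node. -/
def children : RTree → List RTree
  | node cs => cs

/-- Total number of nodes of the tree. -/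
def size : RTree → ℕ
  | node cs => 1 + (cs.attach.map fun c => size c.1).sum
  decreasing_by simp only [RTree.node.sizeOf_spec]; have := List.sizeOf_lt_of_mem c.2; omega

/-- Height of the tree: maximal length of a path from the root to a leaf
(a single node has height `0`). -/
def height : RTree → ℕ
  | node cs => (cs.attach.map fun c => height c.1 + 1).foldr max 0
  decreasing_by simp only [RTree.node.sizeOf_spec]; have := List.sizeOf_lt_of_mem c.2; omega

/-- A property `P` holds for all nodes (subtrees) of the tree. -/
def AllNodes (P : RTree → Prop) : RTree → Prop
  | node cs => P (node cs) ∧ ∀ c ∈ cs.attach, AllNodes P c.1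
  decreasing_by simp only [RTree.node.sizeOf_spec]; have := List.sizeOf_lt_of_mem c.2; omega

/-- Whether the root node is internal, i.e. has at least one child. -/
def isInternal (t : RTree) : Bool := !t.children.isEmpty

theorem size_node (cs : List RTree) : (node cs).size = 1 + (cs.map size).sum := by
  rw [size, List.attach_map_val]

theorem allNodes_node {P : RTree → Prop} {cs : List RTree} :
    (node cs).AllNodes P ↔ P (node cs) ∧ ∀ c ∈ cs, c.AllNodes P := by
  rw [AllNodes]
  simp

theorem height_lt_of_mem {c : RTree} {cs : List RTree} (h : c ∈ cs) :
    c.height < (node cs).height := by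
  rw [height, ← Nat.succ_le_iff]
  exact List.le_max_of_le' 0 (List.mem_map.2 ⟨⟨c, h⟩, List.mem_attach _ _, rfl⟩) le_rfl

theorem size_eq_one_of_not_isInternal {t : RTree} (h : ¬t.isInternal) : t.size = 1 := by
  obtain ⟨cs⟩ := t
  have hcs : cs = [] := by simpa [isInternal, children] using h
  simp [hcs, size_node]

theorem sum_size_le {cs : List RTree} {B : ℕ} (h : ∀ c ∈ cs, c.size ≤ 1 + B) :
    (cs.map size).sum ≤ cs.length + cs.countP isInternal * B := by
  induction cs with
  | nil => simp
  | cons c cs ih =>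
    have ih := ih fun x hx => h x (List.mem_cons_of_mem _ hx)
    have hc := h c List.mem_cons_self
    by_cases hi : c.isInternal
    · simp only [List.map_cons, List.sum_cons, List.length_cons, List.countP_cons_of_pos hi,
        add_mul, one_mul]
      omega
    · simp only [List.map_cons, List.sum_cons, List.length_cons, List.countP_cons_of_neg hi,
        size_eq_one_of_not_isInternal hi]
      omega

end RTree

theorem proof_tree_size_bound (d m w : ℕ) (hm : 1 ≤ m) (t : RTree)
    (hheight : t.height ≤ d)
    (hchildren : t.AllNodes fun s => s.children.length ≤ m)
    (hinternal : t.AllNodes fun s => (s.children.countP RTree.isInternal) ≤ w) :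
    t.size ≤ 1 + m * ∑ i ∈ Finset.range d, w ^ i := by
  induction d generalizing t with
  | zero =>
    obtain ⟨_ | ⟨c, cs⟩⟩ := t
    · simp [RTree.size_node]
    · have := RTree.height_lt_of_mem (List.mem_cons_self (a := c) (l := cs))
      omega
  | succ d ih =>
    obtain ⟨cs⟩ := t
    rw [RTree.allNodes_node] at hchildren hinternal
    have hsum := RTree.sum_size_le fun c hc =>
      ih c (by have := RTree.height_lt_of_mem hc; omega) (hchildren.2 c hc) (hinternal.2 c hc)
    have hlen : cs.length ≤ m := hchildren.1
    have hcount : cs.countP RTree.isInternal ≤ w := hinternal.1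
    calc (RTree.node cs).size
        ≤ 1 + (cs.length + cs.countP RTree.isInternal * (m * ∑ i ∈ Finset.range d, w ^ i)) := by
          rw [RTree.size_node]
          gcongr
      _ ≤ 1 + (m + w * (m * ∑ i ∈ Finset.range d, w ^ i)) := by gcongr
      _ = 1 + m * ∑ i ∈ Finset.range (d + 1), w ^ i := by
          rw [geom_sum_succ]
          ring
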